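/- arXiv:1202.1206 — 3 statements merged into one kernel-verified Lean document; each statement's English description precedes it below -/
import Mathlib

section
/- Composition of formal multilinear series as a sum over set partitions: for every n ≥ 1 and every x ∈ E, n! · (q.comp p)_n(x, …, x) = Σ_{P set partition of {1,…,n}} (|P|)! · ( Π_{B ∈ P} (|B|)! ) · q_{|P|}( p_{|B_1|}(x,…,x), …, p_{|B_k|}(x,…,x) ), where B_1, …, B_k are the blocks of P listed so that min B_1 < ⋯ < min B_k. -/
/-! Core: set partitions of `Fin n` with parts ordered by least element, and the
composition of sequences of multilinear maps along such partitions. -/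

open Function Set

/-- A partition of `Fin n` into finitely many nonempty parts, each part given by its
increasing parameterization, and the parts ordered by increasing least element.
This encodes exactly a set partition of `{1, …, n}` with the blocks listed so that
`min B₁ < ⋯ < min B_k`. -/
@[ext]
structure MinPartition (n : ℕ) where
  /-- The number of parts. -/
  length : ℕ
  /-- The size of each part. -/
  partSize : Fin length → ℕ
  partSize_pos : ∀ m, 0 < partSize m
  /-- The increasing parameterization of each part. -/
  emb : ∀ m, Fin (partSize m) → Fin n
  emb_strictMono : ∀ m, StrictMono (emb m)
  /-- The parts are ordered by increasing least element. -/
  parts_strictMono : StrictMono fun m ↦ emb m ⟨0, partSize_pos m⟩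
  /-- The parts are disjoint. -/
  disjoint : Set.PairwiseDisjoint Set.univ fun m ↦ Set.range (emb m)
  /-- The parts cover everything. -/
  cover : ∀ x, ∃ m, x ∈ Set.range (emb m)

namespace MinPartition

variable {n : ℕ} (c : MinPartition n)

lemma length_le : c.length ≤ n := by
  simpa only [Fintype.card_fin] using Fintype.card_le_of_injective _ c.parts_strictMono.injective

lemma partSize_le (m : Fin c.length) : c.partSize m ≤ n := by
  simpa only [Fintype.card_fin] using Fintype.card_le_of_injective _ (c.emb_strictMono m).injective

/-- Embedding of `MinPartition n` in a sigma type, to derive finiteness. -/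
def embSigma (n : ℕ) : MinPartition n →
    (Σ (l : Fin (n + 1)), Σ (p : Fin l → Fin (n + 1)), Π (i : Fin l), (Fin (p i) → Fin n)) :=
  fun c ↦ ⟨⟨c.length, Order.lt_add_one_iff.mpr c.length_le⟩,
    fun m ↦ ⟨c.partSize m, Order.lt_add_one_iff.mpr (c.partSize_le m)⟩, fun j ↦ c.emb j⟩

lemma injective_embSigma (n : ℕ) : Function.Injective (embSigma n) := by
  rintro ⟨plength, psize, -, pemb, -, -, -, -⟩ ⟨qlength, qsize, -, qemb, -, -, -, -⟩
  intro hpq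
  simp_all only [Sigma.mk.inj_iff, heq_eq_eq, true_and, mk.injEq, and_true, Fin.mk.injEq, embSigma]
  have : plength = qlength := hpq.1
  subst this
  simp_all only [Sigma.mk.inj_iff, heq_eq_eq, true_and, mk.injEq, and_true, Fin.mk.injEq, embSigma]
  ext i
  exact Fin.mk.inj_iff.mp (congr_fun hpq.1 i)

noncomputable instance : Fintype (MinPartition n) :=
  Fintype.ofInjective _ (injective_embSigma n)

end MinPartition

/-- If the fiber of `g` over `i` is parametrized by `Fin k`, it has cardinality `k`. -/
lemma Fintype.card_fiber_of_range_eq {α β : Type*} [Fintype α] [DecidableEq β] {g : α → β}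
    {i : β} {k : ℕ} {f : Fin k → α} (hf : Injective f)
    (h : ∀ x, x ∈ range f ↔ g x = i) : Fintype.card {x // g x = i} = k := by
  rw [← Fintype.card_congr ((Equiv.ofInjective f hf).trans (Equiv.subtypeEquivRight h)),
    Fintype.card_fin]

/-- Two functions with the same fiber cardinalities differ by exactly `∏ᵢ |g⁻¹(i)|!`
permutations of their domain. -/
lemma Equiv.Perm.card_comp_eq {α β : Type*} [Fintype α] [DecidableEq α] [Fintype β]
    [DecidableEq β] {h g : α → β}
    (hc : ∀ i, Fintype.card {x // g x = i} = Fintype.card {x // h x = i}) :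
    Fintype.card {σ : Equiv.Perm α // h ∘ σ = g} =
      ∏ i, (Fintype.card {x // g x = i}).factorial := by
  have hσ₀ := Equiv.ofFiberEquiv_map fun i ↦ Fintype.equivOfCardEq (hc i)
  set σ₀ : Equiv.Perm α := Equiv.ofFiberEquiv fun i ↦ Fintype.equivOfCardEq (hc i)
  rw [← DomMulAct.stabilizer_card g]
  refine Fintype.card_congr ((Equiv.mulLeft σ₀⁻¹).subtypeEquiv fun σ ↦ ?_)
  have : g ∘ (σ₀⁻¹ * σ : Equiv.Perm α) = h ∘ σ := by
    ext x
    simp [← hσ₀]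
  rw [Equiv.coe_mulLeft, this]

/-- The surjections from `Fin n` onto some `Fin k`, i.e. the set partitions of `Fin n` with
arbitrarily ordered blocks. -/
abbrev FinSurjection (n : ℕ) := Σ k : ℕ, {g : Fin n → Fin k // Surjective g}

lemma FinSurjection.exists_equiv_of_eq {n : ℕ} {s t : FinSurjection n} (h : s = t) :
    ∃ e : Fin s.1 ≃ Fin t.1, ∀ x, e (s.2.1 x) = t.2.1 x :=
  h ▸ ⟨Equiv.refl _, fun _ ↦ rfl⟩

namespace Composition

variable {n : ℕ}

lemma index_surjective (c : Composition n) : Surjective c.index := fun i ↦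
  ⟨c.embedding i ⟨0, c.blocks_pos' i i.2⟩, c.index_embedding i _⟩

lemma card_index_eq (c : Composition n) (i : Fin c.length) :
    Fintype.card {x // c.index x = i} = c.blocksFun i :=
  Fintype.card_fiber_of_range_eq (c.embedding i).injective fun x ↦ by
    rw [c.mem_range_embedding_iff', eq_comm]

/-- The surjection obtained by permuting the points and then sending each of them to the block
of `c` containing it. -/
def permIndex (a : Σ _ : Composition n, Equiv.Perm (Fin n)) : FinSurjection n :=
  ⟨a.1.length, a.1.index ∘ a.2, a.1.index_surjective.comp a.2.surjective⟩

lemma card_permIndex_fst (c : Composition n) (σ : Equiv.Perm (Fin n)) (i : Fin c.length) :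
    Fintype.card {x // (c.index ∘ σ) x = i} = c.blocksFun i := by
  rw [← c.card_index_eq]
  exact Fintype.card_congr (σ.subtypeEquiv fun x ↦ Iff.rfl)

/-- Every surjection has the fiber cardinalities of some composition. -/
lemma exists_card_fiber_eq (s : FinSurjection n) :
    ∃ (c : Composition n) (g : {g : Fin n → Fin c.length // Surjective g}),
      s = ⟨c.length, g⟩ ∧ ∀ i, Fintype.card {x // g.1 x = i} = c.blocksFun i := by
  obtain ⟨k, g, hg⟩ := s
  obtain ⟨l, hl, hl'⟩ : ∃ (l : List ℕ) (hl : l.length = k),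
      ∀ i : Fin k, Fintype.card {x // g x = i} = l.get (i.cast hl.symm) :=
    ⟨List.ofFn fun i ↦ Fintype.card {x // g x = i}, List.length_ofFn, fun i ↦ by simp⟩
  subst hl
  refine ⟨⟨l, fun {m} hm ↦ ?_, ?_⟩, ⟨g, hg⟩, rfl, hl'⟩
  · obtain ⟨i, rfl⟩ := List.get_of_mem hm
    obtain ⟨x, hx⟩ := hg i
    have := hl' i
    rw [Fin.cast_refl] at this
    exact this ▸ Fintype.card_pos_iff.2 ⟨⟨x, hx⟩⟩
  · have h : ∑ i : Fin l.length, l.get i = n := by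
      rw [← Fintype.card_fin n, ← Fintype.card_congr (Equiv.sigmaFiberEquiv g),
        Fintype.card_sigma]
      exact Finset.sum_congr rfl fun i _ ↦ (hl' i).symm
    rw [← h, ← List.sum_ofFn, List.ofFn_get]

/-- The fiber of `permIndex` over a surjection `g` has `∏ᵢ |g⁻¹(i)|!` elements. -/
lemma card_permIndex_eq (s : FinSurjection n) :
    Fintype.card {a // permIndex (n := n) a = s} =
      ∏ i, (Fintype.card {x // s.2.1 x = i}).factorial := by
  obtain ⟨c, ⟨g, hg⟩, rfl, hc⟩ := exists_card_fiber_eq s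
  rw [← Equiv.Perm.card_comp_eq (h := c.index) fun i ↦ (hc i).trans (c.card_index_eq i).symm]
  let f (σ : {σ : Equiv.Perm (Fin n) // c.index ∘ σ = g}) :
      {a // permIndex a = ⟨c.length, g, hg⟩} := ⟨⟨c, σ.1⟩, by simp [permIndex, σ.2]⟩
  refine (Fintype.card_of_bijective (f := f) ⟨?_, ?_⟩).symm
  · intro σ τ h
    simpa [f, Subtype.ext_iff] using h
  · rintro ⟨⟨c', σ⟩, h⟩
    have hb : c' = c := by
      have := congrArg (fun s : FinSurjection n ↦
        List.ofFn fun i ↦ Fintype.card {x // s.2.1 x = i}) h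
      change (List.ofFn fun i ↦ Fintype.card {x // (c'.index ∘ σ) x = i}) =
        List.ofFn fun i ↦ Fintype.card {x // g x = i} at this
      simp only [card_permIndex_fst, hc, ofFn_blocksFun] at this
      exact Composition.ext this
    subst hb
    simp only [permIndex, Sigma.mk.injEq, heq_eq_eq, true_and, Subtype.mk.injEq] at h
    exact ⟨⟨σ, h⟩, rfl⟩

lemma permIndex_surjective : Surjective (permIndex (n := n)) := fun s ↦ by
  have h : 0 < Fintype.card {a // permIndex (n := n) a = s} := by
    rw [card_permIndex_eq]
    exact Finset.prod_pos fun i _ ↦ Nat.factorial_pos _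
  obtain ⟨a, ha⟩ := Fintype.card_pos_iff.1 h
  exact ⟨a, ha⟩

end Composition

instance (n : ℕ) : Finite (FinSurjection n) :=
  Finite.of_surjective _ Composition.permIndex_surjective

noncomputable instance (n : ℕ) : Fintype (FinSurjection n) := Fintype.ofFinite _

namespace MinPartition

variable {n : ℕ} (c : MinPartition n)

/-- The index of the part containing a given point. -/
noncomputable def index (x : Fin n) : Fin c.length := (c.cover x).choose

lemma mem_range_emb_index (x : Fin n) : x ∈ range (c.emb (c.index x)) := (c.cover x).choose_spec

lemma mem_range_emb_iff {x : Fin n} {m : Fin c.length} :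
    x ∈ range (c.emb m) ↔ c.index x = m := by
  refine ⟨fun h ↦ ?_, fun h ↦ h ▸ c.mem_range_emb_index x⟩
  by_contra hne
  exact Set.disjoint_left.1 (c.disjoint (mem_univ _) (mem_univ _) hne) (c.mem_range_emb_index x) h

@[simp]
lemma index_emb (m : Fin c.length) (j : Fin (c.partSize m)) : c.index (c.emb m j) = m :=
  c.mem_range_emb_iff.1 ⟨j, rfl⟩

lemma index_surjective : Surjective c.index := fun m ↦ ⟨_, c.index_emb m ⟨0, c.partSize_pos m⟩⟩

lemma card_index_eq (m : Fin c.length) :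
    Fintype.card {x // c.index x = m} = c.partSize m :=
  Fintype.card_fiber_of_range_eq (c.emb_strictMono m).injective fun _ ↦ c.mem_range_emb_iff

/-- The least element of a part. -/
def least (m : Fin c.length) : Fin n := c.emb m ⟨0, c.partSize_pos m⟩

@[simp]
lemma index_least (m : Fin c.length) : c.index (c.least m) = m := c.index_emb m _

lemma least_index_le (x : Fin n) : c.least (c.index x) ≤ x := by
  obtain ⟨j, hj⟩ := c.mem_range_emb_index x
  calc c.least (c.index x) ≤ c.emb (c.index x) j :=
        (c.emb_strictMono _).monotone (Fin.mk_le_of_le_val (Nat.zero_le _))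
    _ = x := hj

lemma least_strictMono : StrictMono c.least := c.parts_strictMono

/-- A set partition is determined by its index function. -/
lemma eq_of_index_eq {c d : MinPartition n} (hl : c.length = d.length)
    (h : ∀ x, (c.index x).cast hl = d.index x) : c = d := by
  have hr (m) : range (c.emb m) = range (d.emb (m.cast hl)) := by
    ext x
    rw [mem_range_emb_iff, mem_range_emb_iff, ← h, Fin.cast_inj]
  obtain ⟨k, s, s_pos, e, e_mono, e_parts, e_disj, e_cover⟩ := c
  obtain ⟨k', s', s'_pos, e', e'_mono, e'_parts, e'_disj, e'_cover⟩ := d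
  dsimp only at hl
  subst hl
  have hr (m) : range (e m) = range (e' m) := hr m
  obtain rfl : s = s' := by
    ext m
    rw [← Nat.card_fin (s m), ← Nat.card_fin (s' m),
      ← Nat.card_range_of_injective (e_mono m).injective,
      ← Nat.card_range_of_injective (e'_mono m).injective, hr]
  obtain rfl : e = e' := by
    ext1 m
    exact (StrictMono.range_inj (e_mono m) (e'_mono m)).1 (hr m)
  rfl

/-- Two set partitions whose index functions differ by a bijection of the labels are equal. -/
lemma eq_of_equiv_index {c d : MinPartition n} (ρ : Fin c.length ≃ Fin d.length)
    (h : ∀ x, ρ (c.index x) = d.index x) : c = d := by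
  have hleast (m) : d.least (ρ m) = c.least m := by
    apply le_antisymm
    · simpa [← h] using d.least_index_le (c.least m)
    · have := c.least_index_le (d.least (ρ m))
      rwa [show c.index (d.least (ρ m)) = m from ρ.injective (by rw [h, index_least])] at this
  let e : Fin c.length ≃o Fin d.length :=
    { ρ with
      map_rel_iff' := fun {i j} ↦ by
        rw [← d.least_strictMono.le_iff_le, ← c.least_strictMono.le_iff_le]
        simp [hleast] }
  refine eq_of_index_eq (by simpa using Fintype.card_congr ρ) fun x ↦ Fin.ext ?_
  rw [Fin.val_cast, ← Fin.coe_orderIso_apply e, ← h]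
  rfl

/-- The surjection sending each point to the label, under a permutation of the labels, of the
part containing it. -/
noncomputable def indexPerm (a : Σ c : MinPartition n, Equiv.Perm (Fin c.length)) :
    FinSurjection n :=
  ⟨a.1.length, a.2 ∘ a.1.index, a.2.surjective.comp a.1.index_surjective⟩

lemma indexPerm_injective : Injective (indexPerm (n := n)) := by
  rintro ⟨c, σ⟩ ⟨d, τ⟩ h
  obtain ⟨e, he⟩ : ∃ e : Fin c.length ≃ Fin d.length, ∀ x, e (σ (c.index x)) = τ (d.index x) :=
    FinSurjection.exists_equiv_of_eq h
  obtain rfl := eq_of_equiv_index ((σ.trans e).trans τ.symm) fun x ↦ by simp [he]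
  simp only [indexPerm, Sigma.mk.injEq, heq_eq_eq, true_and, Subtype.mk.injEq] at h
  rw [DFunLike.coe_injective (c.index_surjective.injective_comp_right h)]

/-- A labelling whose fibers have increasing least elements `a 0 < a 1 < ⋯` is the index function
of a set partition. -/
lemma exists_index_eq {k : ℕ} (g : Fin n → Fin k) (a : Fin k → Fin n) (ha : StrictMono a)
    (hga : ∀ i, g (a i) = i) (hle : ∀ x, a (g x) ≤ x) :
    ∃ (c : MinPartition n) (hl : c.length = k), ∀ x, (c.index x).cast hl = g x := by
  let s (i : Fin k) : Finset (Fin n) := {x | g x = i}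
  have hs {i x} : x ∈ s i ↔ g x = i := by simp [s]
  have hpos (i) : 0 < (s i).card := Finset.card_pos.2 ⟨a i, hs.2 (hga i)⟩
  have hmin (i) : (s i).orderEmbOfFin rfl ⟨0, hpos i⟩ = a i := by
    rw [Finset.orderEmbOfFin_zero]
    refine le_antisymm (Finset.min'_le _ _ (hs.2 (hga i))) (Finset.le_min' _ _ _ fun x hx ↦ ?_)
    simpa [hs.1 hx] using hle x
  let c : MinPartition n :=
    { length := k
      partSize i := (s i).card
      partSize_pos := hpos
      emb i := (s i).orderEmbOfFin rfl
      emb_strictMono i := OrderEmbedding.strictMono _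
      parts_strictMono := by simpa only [hmin] using ha
      disjoint i _ j _ hij := by
        simp only [Function.onFun, Finset.range_orderEmbOfFin]
        refine Set.disjoint_left.2 fun x hx hx' ↦ hij ?_
        rw [← hs.1 hx, ← hs.1 hx']
      cover x := ⟨g x, by simp [s]⟩ }
  refine ⟨c, rfl, fun x ↦ c.mem_range_emb_iff.1 ?_⟩
  change x ∈ range ((s (g x)).orderEmbOfFin rfl)
  simp [s]

lemma indexPerm_surjective : Surjective (indexPerm (n := n)) := by
  rintro ⟨k, g, hg⟩
  have hne (i) : ({x | g x = i} : Finset (Fin n)).Nonempty := by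
    obtain ⟨x, hx⟩ := hg i
    exact ⟨x, by simpa using hx⟩
  let a (i : Fin k) : Fin n := Finset.min' _ (hne i)
  have hga (i) : g (a i) = i := by simpa using Finset.min'_mem _ (hne i)
  have hle (x) : a (g x) ≤ x := Finset.min'_le _ _ (by simp)
  have ha : Injective a := LeftInverse.injective hga
  let σ := Tuple.sort a
  obtain ⟨c, rfl, hc⟩ := exists_index_eq (σ.symm ∘ g) (a ∘ σ)
    ((Tuple.monotone_sort a).strictMono_of_injective (ha.comp σ.injective))
    (fun i ↦ by simp [hga]) (fun x ↦ by simpa using hle x)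
  refine ⟨⟨c, σ⟩, ?_⟩
  have : σ ∘ c.index = g := by
    ext1 x
    simpa [Equiv.eq_symm_apply] using hc x
  simp [indexPerm, this]

end MinPartition

namespace FormalMultilinearSeries

variable {𝕜 E : Type*} [NontriviallyNormedField 𝕜] [NormedAddCommGroup E] [NormedSpace 𝕜 E]

/-- The value of `q` along the fibers of a surjection, with each fiber `B` contributing
`p_{|B|} (x, …, x)`. -/
noncomputable def compAlongFibers (q p : FormalMultilinearSeries 𝕜 E E) (x : E) {n : ℕ}
    (s : FinSurjection n) : E :=
  q s.1 fun i ↦ p (Fintype.card {y // s.2.1 y = i}) fun _ ↦ x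

lemma factorial_smul_comp_apply_const (q p : FormalMultilinearSeries 𝕜 E E) (n : ℕ) (x : E) :
    n.factorial • (q.comp p) n (fun _ ↦ x) =
      ∑ s : FinSurjection n, (∏ i, (Fintype.card {y // s.2.1 y = i}).factorial) •
        q.compAlongFibers p x s := by
  classical
  calc n.factorial • (q.comp p) n (fun _ ↦ x)
    _ = ∑ c : Composition n, ∑ _ : Equiv.Perm (Fin n),
          q c.length fun i ↦ p (c.blocksFun i) fun _ ↦ x := by
      simp only [Finset.sum_const, Finset.card_univ, Fintype.card_perm, Fintype.card_fin,
        ← Finset.smul_sum, FormalMultilinearSeries.comp, sum_apply,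
        compAlongComposition_apply]
      rfl
    _ = ∑ a, q.compAlongFibers p x (Composition.permIndex (n := n) a) := by
      rw [Fintype.sum_sigma]
      refine Finset.sum_congr rfl fun c _ ↦ Finset.sum_congr rfl fun σ _ ↦ ?_
      exact congrArg (q c.length) <| funext fun i ↦
        congrArg (fun k ↦ p k fun _ ↦ x) (c.card_permIndex_fst σ i).symm
    _ = _ := by
      rw [← Fintype.sum_fiberwise' Composition.permIndex]
      simp only [Finset.sum_const, Finset.card_univ, Composition.card_permIndex_eq]

lemma compAlongFibers_indexPerm (q p : FormalMultilinearSeries 𝕜 E E)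
    (hq : ∀ (n : ℕ) (σ : Equiv.Perm (Fin n)) (v : Fin n → E), q n (v ∘ σ) = q n v)
    (x : E) {n : ℕ} (P : MinPartition n) (σ : Equiv.Perm (Fin P.length)) :
    (∏ i, (Fintype.card {y // (MinPartition.indexPerm ⟨P, σ⟩).2.1 y = i}).factorial) •
        q.compAlongFibers p x (MinPartition.indexPerm ⟨P, σ⟩) =
      (∏ m, (P.partSize m).factorial) • q P.length fun m ↦ p (P.partSize m) fun _ ↦ x := by
  have hcard (i : Fin P.length) :
      Fintype.card {y // (σ ∘ P.index) y = i} = P.partSize (σ.symm i) := by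
    rw [← P.card_index_eq]
    exact Fintype.card_congr (Equiv.subtypeEquivRight fun y ↦ by simp [Equiv.eq_symm_apply])
  change (∏ i : Fin P.length, (Fintype.card {y // (σ ∘ P.index) y = i}).factorial) •
    (q P.length fun i ↦ p (Fintype.card {y // (σ ∘ P.index) y = i}) fun _ ↦ x) = _
  have hv : (fun i ↦ p (Fintype.card {y // (σ ∘ P.index) y = i}) fun _ ↦ x) =
      (fun m ↦ p (P.partSize m) fun _ ↦ x) ∘ σ.symm :=
    funext fun i ↦ congrArg (fun k ↦ p k fun _ ↦ x) (hcard i)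
  rw [hv, hq]
  simp only [hcard]
  rw [Equiv.prod_comp σ.symm fun m ↦ (P.partSize m).factorial]

end FormalMultilinearSeries

variable {𝕜 : Type*} [NontriviallyNormedField 𝕜]
  {E : Type*} [NormedAddCommGroup E] [NormedSpace 𝕜 E]

/-- **Composition of formal multilinear series as a sum over set partitions**: if `p₀ = 0`
and every `qₙ` is symmetric, then for every `n ≥ 1` and every `x`,
`n! · (q.comp p)ₙ (x, …, x) = ∑_{P set partition of {1,…,n}} |P|! · (∏_{B ∈ P} |B|!) ·
q_{|P|} (p_{|B₁|} (x,…,x), …, p_{|B_k|} (x,…,x))`, where the blocks `B₁, …, B_k` of `P` are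
listed so that `min B₁ < ⋯ < min B_k` (a partition `P : MinPartition n` carries exactly
this data: `P.length = |P|` parts, the `ℓ`-th part in increasing-minima order having
`P.partSize ℓ` elements). -/
theorem comp_eq_sum_partitions (p q : FormalMultilinearSeries 𝕜 E E)
    (hp : p 0 = 0)
    (hq : ∀ (n : ℕ) (σ : Equiv.Perm (Fin n)) (v : Fin n → E), q n (v ∘ σ) = q n v)
    (n : ℕ) (hn : 1 ≤ n) (x : E) :
    n.factorial • (q.comp p) n (fun _ ↦ x) =
      ∑ P : MinPartition n,
        (P.length.factorial * ∏ m, (P.partSize m).factorial) •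
          q P.length (fun m ↦ p (P.partSize m) (fun _ ↦ x)) := by
  rw [q.factorial_smul_comp_apply_const,
    ← Bijective.sum_comp ⟨MinPartition.indexPerm_injective, MinPartition.indexPerm_surjective⟩,
    Fintype.sum_sigma]
  simp only [q.compAlongFibers_indexPerm p hq, Finset.sum_const, Finset.card_univ,
    Fintype.card_perm, Fintype.card_fin, mul_smul]
end

section
/- Gluing lemma for one-particle irreducibility: let Γ be a graph and J ⊆ V(Γ) with 2 ≤ |J| < |V(Γ)|. If the subgraph Γ_J is 1PI and the contracted graph Γ/J is 1PI, then Γ is 1PI. -/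
/-! Core: finite graphs given by flags with an involution, connectedness,
one-particle irreducibility, subgraphs and contraction. -/

/-- A graph: a finite set of vertices `Vt`, a finite set of flags (half-edges) `Ft`,
an attachment map `bd : Ft → Vt` and an involution `inv : Ft → Ft`. Pairs `{f, inv f}`
with `inv f ≠ f` are the internal edges; flags with `inv f = f` are the external lines. -/
structure FGraph where
  /-- vertices -/
  Vt : Type
  /-- flags (half-edges) -/
  Ft : Type
  [fintypeVt : Fintype Vt]
  [fintypeFt : Fintype Ft]
  [decEqVt : DecidableEq Vt]
  [decEqFt : DecidableEq Ft]
  /-- the vertex to which a flag is attached -/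
  bd : Ft → Vt
  /-- the involution pairing flags into edges -/
  inv : Ft → Ft
  inv_invol : ∀ f, inv (inv f) = f

attribute [instance] FGraph.fintypeVt FGraph.fintypeFt FGraph.decEqVt FGraph.decEqFt

namespace FGraph

variable (G : FGraph)

/-- Two vertices are adjacent if some internal edge joins them. -/
def Adj (v w : G.Vt) : Prop :=
  ∃ f : G.Ft, G.inv f ≠ f ∧ G.bd f = v ∧ G.bd (G.inv f) = w

/-- A graph is connected if it is nonempty and any two vertices are joined by a chain of
internal edges. -/
def Connected : Prop :=
  Nonempty G.Vt ∧ ∀ v w : G.Vt, Relation.ReflTransGen G.Adj v w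

/-- A tadpole is an internal edge whose two ends are attached to the same vertex. -/
def NoTadpole : Prop := ∀ f : G.Ft, G.inv f ≠ f → G.bd f ≠ G.bd (G.inv f)

/-- Cutting the internal edge `{f₀, inv f₀}`: the involution now fixes `f₀` and `inv f₀`
and agrees with `inv` elsewhere. -/
def cut (f₀ : G.Ft) : FGraph where
  Vt := G.Vt
  Ft := G.Ft
  bd := G.bd
  inv f := if f = f₀ ∨ f = G.inv f₀ then f else G.inv f
  inv_invol f := by
    by_cases h : f = f₀ ∨ f = G.inv f₀
    · simp [h]
    · push_neg at h
      have h1 : G.inv f ≠ f₀ := fun he ↦ h.2 (by rw [← he, G.inv_invol])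
      have h2 : G.inv f ≠ G.inv f₀ := fun he ↦
        h.1 (by simpa [G.inv_invol] using congrArg G.inv he)
      simp [h, h1, h2, G.inv_invol]

/-- One-particle irreducibility: connected, at least two vertices, no tadpoles, and still
connected after cutting any single internal edge. -/
def Is1PI : Prop :=
  G.Connected ∧ 2 ≤ Fintype.card G.Vt ∧ G.NoTadpole ∧
    ∀ f₀ : G.Ft, G.inv f₀ ≠ f₀ → (G.cut f₀).Connected

/-- The subgraph spanned by a set of vertices `J`: its flags are the flags attached to `J`,
and its involution agrees with that of `G` on pairs of flags both attached to `J` and fixes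
the remaining flags. -/
def subgraph (J : Finset G.Vt) : FGraph where
  Vt := {v : G.Vt // v ∈ J}
  Ft := {f : G.Ft // G.bd f ∈ J}
  bd f := ⟨G.bd f.1, f.2⟩
  inv f := if h : G.bd (G.inv f.1) ∈ J then ⟨G.inv f.1, h⟩ else f
  inv_invol f := by
    by_cases h : G.bd (G.inv f.1) ∈ J
    · simp only [h, dite_true]
      have h' : G.bd (G.inv (G.inv f.1)) ∈ J := by rw [G.inv_invol]; exact f.2
      simp only [h', dite_true]
      exact Subtype.ext (G.inv_invol f.1)
    · simp [h]

/-- The contraction `G/J`: the vertices of `J` are replaced by a single new vertex (`none`),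
the internal edges of the subgraph spanned by `J` are removed, and the remaining flags
attached to `J` are re-attached to the new vertex. -/
def contract (J : Finset G.Vt) : FGraph where
  Vt := Option {v : G.Vt // v ∉ J}
  Ft := {f : G.Ft // ¬(G.inv f ≠ f ∧ G.bd f ∈ J ∧ G.bd (G.inv f) ∈ J)}
  bd f := if h : G.bd f.1 ∈ J then none else some ⟨G.bd f.1, h⟩
  inv f := ⟨G.inv f.1, by
    obtain ⟨f, hf⟩ := f
    intro ⟨h1, h2, h3⟩
    rw [G.inv_invol] at h1 h3
    exact hf ⟨fun he ↦ h1 he.symm, h3, h2⟩⟩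
  inv_invol f := Subtype.ext (G.inv_invol f.1)

end FGraph

namespace FGraph

/-- The map on vertices collapsing `J` to the contracted vertex. -/
def toContract (G : FGraph) (J : Finset G.Vt) (v : G.Vt) : (G.contract J).Vt :=
  if h : v ∈ J then none else some ⟨v, h⟩

theorem toContract_eq_iff (G : FGraph) {J : Finset G.Vt} {v w : G.Vt} :
    G.toContract J v = G.toContract J w ↔ v = w ∨ v ∈ J ∧ w ∈ J := by
  unfold toContract
  by_cases hv : v ∈ J <;> by_cases hw : w ∈ J <;> simp [contract, hv, hw] <;> grind

/-- A relation on the vertices connects everything if it connects `J` and induces a relation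
connecting the vertices of the contraction. -/
theorem reflTransGen_of_contract (G : FGraph) {J : Finset G.Vt}
    {R : G.Vt → G.Vt → Prop} {Q : (G.contract J).Vt → (G.contract J).Vt → Prop}
    (hR : ∀ v ∈ J, ∀ w ∈ J, Relation.ReflTransGen R v w)
    (hQ : ∀ a b, Q a b → ∃ v w, G.toContract J v = a ∧ G.toContract J w = b ∧ R v w)
    (hconn : ∀ a b, Relation.ReflTransGen Q a b) (v w : G.Vt) :
    Relation.ReflTransGen R v w := by
  have fiber {x y : G.Vt} (h : G.toContract J x = G.toContract J y) :
      Relation.ReflTransGen R x y := by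
    obtain rfl | ⟨hx, hy⟩ := G.toContract_eq_iff.1 h
    exacts [.refl, hR x hx y hy]
  suffices ∀ b, Relation.ReflTransGen Q (G.toContract J v) b →
      ∀ w, G.toContract J w = b → Relation.ReflTransGen R v w from
    this _ (hconn _ _) w rfl
  intro b h
  induction h with
  | refl => exact fun w hw ↦ fiber hw.symm
  | tail _ hbc ih =>
    intro w hw
    obtain ⟨x, y, hx, hy, hxy⟩ := hQ _ _ hbc
    exact ((ih x hx).tail hxy).trans (fiber (hy.trans hw.symm))

theorem cut_adj_iff (G : FGraph) (f₀ : G.Ft) (v w : G.Vt) :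
    (G.cut f₀).Adj v w ↔
      ∃ f, G.inv f ≠ f ∧ f ≠ f₀ ∧ f ≠ G.inv f₀ ∧ G.bd f = v ∧ G.bd (G.inv f) = w := by
  constructor
  · rintro ⟨f, hf, hv, hw⟩
    by_cases h : f = f₀ ∨ f = G.inv f₀
    · exact absurd (if_pos h) hf
    · have e : (G.cut f₀).inv f = G.inv f := if_neg h
      rw [e] at hf hw
      exact ⟨f, hf, fun h' ↦ h (.inl h'), fun h' ↦ h (.inr h'), hv, hw⟩
  · rintro ⟨f, hf, h1, h2, hv, hw⟩
    have e : (G.cut f₀).inv f = G.inv f := if_neg (not_or.2 ⟨h1, h2⟩)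
    exact ⟨f, by rwa [e], hv, by rw [e]; exact hw⟩

theorem subgraph_inv_of_mem (G : FGraph) {J : Finset G.Vt} {f : (G.subgraph J).Ft}
    (h : G.bd (G.inv f.1) ∈ J) : (G.subgraph J).inv f = ⟨G.inv f.1, h⟩ :=
  dif_pos h

theorem bd_inv_mem_of_subgraph_inv_ne (G : FGraph) {J : Finset G.Vt} {f : (G.subgraph J).Ft}
    (h : (G.subgraph J).inv f ≠ f) : G.bd (G.inv f.1) ∈ J := by
  by_contra h'
  exact h (dif_neg h')

theorem noTadpole_of_subgraph_of_contract (G : FGraph) {J : Finset G.Vt}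
    (hsub : (G.subgraph J).NoTadpole) (hquot : (G.contract J).NoTadpole) : G.NoTadpole := by
  intro f hf he
  by_cases h : G.bd f ∈ J
  · have h' : G.bd (G.inv f) ∈ J := he ▸ h
    have e := G.subgraph_inv_of_mem (f := ⟨f, h⟩) h'
    refine hsub ⟨f, h⟩ ?_ ?_ <;> rw [e]
    · exact fun h'' ↦ hf (congrArg Subtype.val h'')
    · exact Subtype.ext he
  · exact hquot ⟨f, fun h' ↦ h h'.2.1⟩ (fun h' ↦ hf (congrArg Subtype.val h'))
      (congrArg (G.toContract J) he)

theorem reflTransGen_of_subgraph (G : FGraph) {J : Finset G.Vt} {R : G.Vt → G.Vt → Prop}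
    {S : (G.subgraph J).Vt → (G.subgraph J).Vt → Prop}
    (hS : ∀ a b, S a b → R a.1 b.1) (hconn : ∀ a b, Relation.ReflTransGen S a b) :
    ∀ v ∈ J, ∀ w ∈ J, Relation.ReflTransGen R v w :=
  fun v hv w hw ↦ (hconn ⟨v, hv⟩ ⟨w, hw⟩).lift Subtype.val hS

theorem connected_of_subgraph_of_contract (G : FGraph) {J : Finset G.Vt} (hJ : J.Nonempty)
    (hsub : (G.subgraph J).Connected) (hquot : (G.contract J).Connected) : G.Connected := by
  refine ⟨hJ.to_type, G.reflTransGen_of_contract (G.reflTransGen_of_subgraph ?_ hsub.2) ?_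
    hquot.2⟩
  · rintro _ _ ⟨f, hf, rfl, rfl⟩
    have e := G.subgraph_inv_of_mem (G.bd_inv_mem_of_subgraph_inv_ne hf)
    rw [e] at hf ⊢
    exact ⟨f.1, fun h ↦ hf (Subtype.ext h), rfl, rfl⟩
  · rintro _ _ ⟨f, hf, rfl, rfl⟩
    exact ⟨_, _, rfl, rfl, f.1, fun h ↦ hf (Subtype.ext h), rfl, rfl⟩

/-- Cutting an edge inside `J` keeps the graph connected if the cut subgraph is connected. -/
theorem cut_connected_of_mem (G : FGraph) {J : Finset G.Vt} {f₀ : G.Ft} (hf₀ : G.inv f₀ ≠ f₀)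
    (h : G.bd f₀ ∈ J) (h' : G.bd (G.inv f₀) ∈ J)
    (hsub : ((G.subgraph J).cut ⟨f₀, h⟩).Connected) (hquot : (G.contract J).Connected) :
    (G.cut f₀).Connected := by
  refine ⟨⟨G.bd f₀⟩, G.reflTransGen_of_contract
    (G.reflTransGen_of_subgraph ?_ hsub.2) ?_ hquot.2⟩
  · intro a b hab
    obtain ⟨f, hf, h1, h2, rfl, rfl⟩ := ((G.subgraph J).cut_adj_iff _ _ _).1 hab
    have e := G.subgraph_inv_of_mem (G.bd_inv_mem_of_subgraph_inv_ne hf)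
    have e₀ := G.subgraph_inv_of_mem (f := ⟨f₀, h⟩) h'
    rw [e] at hf ⊢
    rw [e₀] at h2
    exact (G.cut_adj_iff _ _ _).2 ⟨f.1, fun h ↦ hf (Subtype.ext h), fun h ↦ h1 (Subtype.ext h),
      fun h ↦ h2 (Subtype.ext h), rfl, rfl⟩
  · rintro _ _ ⟨f, hf, rfl, rfl⟩
    refine ⟨_, _, rfl, rfl, (G.cut_adj_iff _ _ _).2
      ⟨f.1, fun h ↦ hf (Subtype.ext h), fun e ↦ f.2 ?_, fun e ↦ f.2 ?_, rfl, rfl⟩⟩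
    · rw [e]
      exact ⟨hf₀, h, h'⟩
    · rw [e, G.inv_invol]
      exact ⟨hf₀.symm, h', h⟩

/-- Cutting an edge not inside `J` keeps the graph connected if the cut contraction is
connected. -/
theorem cut_connected_of_notMem (G : FGraph) {J : Finset G.Vt} (hJ : J.Nonempty) {f₀ : G.Ft}
    (h : ¬(G.inv f₀ ≠ f₀ ∧ G.bd f₀ ∈ J ∧ G.bd (G.inv f₀) ∈ J))
    (hsub : (G.subgraph J).Connected) (hquot : ((G.contract J).cut ⟨f₀, h⟩).Connected) :
    (G.cut f₀).Connected := by
  refine ⟨hJ.to_type, G.reflTransGen_of_contract (G.reflTransGen_of_subgraph ?_ hsub.2) ?_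
    hquot.2⟩
  · rintro _ _ ⟨f, hf, rfl, rfl⟩
    have hm := G.bd_inv_mem_of_subgraph_inv_ne hf
    have e := G.subgraph_inv_of_mem hm
    rw [e] at hf ⊢
    have hne : G.inv f.1 ≠ f.1 := fun h ↦ hf (Subtype.ext h)
    refine (G.cut_adj_iff _ _ _).2 ⟨f.1, hne, fun e ↦ h ?_, fun e ↦ h ?_, rfl, rfl⟩
    · exact e ▸ ⟨hne, f.2, hm⟩
    · have e' : f₀ = G.inv f.1 := by rw [e, G.inv_invol]
      rw [e', G.inv_invol]
      exact ⟨hne.symm, hm, f.2⟩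
  · intro a b hab
    obtain ⟨f, hf, h1, h2, rfl, rfl⟩ := ((G.contract J).cut_adj_iff _ _ _).1 hab
    exact ⟨_, _, rfl, rfl, (G.cut_adj_iff _ _ _).2 ⟨f.1, fun h ↦ hf (Subtype.ext h),
      fun h ↦ h1 (Subtype.ext h), fun h ↦ h2 (Subtype.ext h), rfl, rfl⟩⟩

end FGraph

/-- **Gluing lemma for one-particle irreducibility**: if `J ⊆ V(Γ)` with `2 ≤ |J| < |V(Γ)|`,
the subgraph `Γ_J` is 1PI and the contracted graph `Γ/J` is 1PI, then `Γ` is 1PI. -/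
theorem is1PI_of_subgraph_of_contract (G : FGraph) (J : Finset G.Vt)
    (h2 : 2 ≤ J.card) (hlt : J.card < Fintype.card G.Vt)
    (hsub : (G.subgraph J).Is1PI) (hquot : (G.contract J).Is1PI) :
    G.Is1PI := by
  obtain ⟨hsc, -, hst, hscut⟩ := hsub
  obtain ⟨hqc, -, hqt, hqcut⟩ := hquot
  have hJ : J.Nonempty := Finset.card_pos.1 (by omega)
  refine ⟨G.connected_of_subgraph_of_contract hJ hsc hqc, by omega,
    G.noTadpole_of_subgraph_of_contract hst hqt, fun f₀ hf₀ ↦ ?_⟩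
  by_cases h : G.inv f₀ ≠ f₀ ∧ G.bd f₀ ∈ J ∧ G.bd (G.inv f₀) ∈ J
  · refine G.cut_connected_of_mem hf₀ h.2.1 h.2.2 (hscut _ ?_) hqc
    rw [G.subgraph_inv_of_mem (f := ⟨f₀, h.2.1⟩) h.2.2]
    exact fun e ↦ hf₀ (congrArg Subtype.val e)
  · exact G.cut_connected_of_notMem hJ h hsc
      (hqcut ⟨f₀, h⟩ fun e ↦ hf₀ (congrArg Subtype.val e))
end

section
/- Contraction preserves connectedness and one-particle irreducibility: if a graph Γ is connected and J ⊆ V(Γ) is nonempty, then the contracted graph Γ/J is connected; if Γ is 1PI and J ⊆ V(Γ) is nonempty with J ≠ V(Γ), then Γ/J is 1PI. -/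
namespace FGraph

theorem Connected.of_surjective {G H : FGraph} (hG : G.Connected) (p : G.Vt → H.Vt)
    (hp : Function.Surjective p)
    (hadj : ∀ v w, G.Adj v w → Relation.ReflTransGen H.Adj (p v) (p w)) : H.Connected := by
  refine ⟨hG.1.map p, fun v w ↦ ?_⟩
  obtain ⟨v, rfl⟩ := hp v
  obtain ⟨w, rfl⟩ := hp w
  exact Relation.ReflTransGen.lift' p hadj _ _ (hG.2 v w)

/-- The projection of the vertices of `G` onto those of the contraction `G/J`. -/
def contractProj (G : FGraph) (J : Finset G.Vt) (v : G.Vt) : Option {v : G.Vt // v ∉ J} :=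
  if h : v ∈ J then none else some ⟨v, h⟩

theorem contractProj_surjective (G : FGraph) {J : Finset G.Vt} (hJ : J.Nonempty) :
    Function.Surjective (G.contractProj J) := by
  rintro (_ | ⟨v, hv⟩)
  · obtain ⟨v, hv⟩ := hJ
    exact ⟨v, dif_pos hv⟩
  · exact ⟨v, dif_neg hv⟩

theorem contractProj_eq_of_mem (G : FGraph) {J : Finset G.Vt} {v w : G.Vt} (hv : v ∈ J)
    (hw : w ∈ J) : G.contractProj J v = G.contractProj J w := by
  rw [contractProj, contractProj, dif_pos hv, dif_pos hw]

theorem contractProj_eq_iff (G : FGraph) {J : Finset G.Vt} {v w : G.Vt} :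
    G.contractProj J v = G.contractProj J w ↔ v = w ∨ v ∈ J ∧ w ∈ J := by
  refine ⟨fun h ↦ ?_, ?_⟩
  · by_cases hv : v ∈ J <;> by_cases hw : w ∈ J
    · exact .inr ⟨hv, hw⟩
    · rw [contractProj, contractProj, dif_pos hv, dif_neg hw] at h
      cases h
    · rw [contractProj, contractProj, dif_neg hv, dif_pos hw] at h
      cases h
    · rw [contractProj, contractProj, dif_neg hv, dif_neg hw] at h
      exact .inl (congrArg Subtype.val (Option.some.inj h))
  · rintro (rfl | ⟨hv, hw⟩)
    · rfl
    · exact G.contractProj_eq_of_mem hv hw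

theorem Connected.contract {G : FGraph} {J : Finset G.Vt} (hG : G.Connected)
    (hJ : J.Nonempty) : (G.contract J).Connected := by
  refine hG.of_surjective (G.contractProj J) (G.contractProj_surjective hJ) ?_
  rintro _ _ ⟨f, hf, rfl, rfl⟩
  by_cases h : G.bd f ∈ J ∧ G.bd (G.inv f) ∈ J
  · rw [G.contractProj_eq_of_mem h.1 h.2]
    exact .refl
  · exact .single ⟨⟨f, fun h' ↦ h h'.2⟩, fun he ↦ hf (congrArg Subtype.val he), rfl, rfl⟩

theorem NoTadpole.contract {G : FGraph} (hG : G.NoTadpole) (J : Finset G.Vt) :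
    (G.contract J).NoTadpole := by
  rintro ⟨f, hf⟩ hne heq
  have hne' : G.inv f ≠ f := fun he ↦ hne (Subtype.ext he)
  rcases G.contractProj_eq_iff.1 heq with h | h
  · exact hG f hne' h
  · exact hf ⟨hne', h⟩

theorem Connected.cut_contract {G : FGraph} {J : Finset G.Vt} (f₀ : (G.contract J).Ft)
    (hG : (G.cut f₀.1).Connected) (hJ : J.Nonempty) :
    ((G.contract J).cut f₀).Connected := by
  refine hG.of_surjective (G.contractProj J) (G.contractProj_surjective hJ) ?_
  rintro _ _ ⟨f, hf, rfl, rfl⟩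
  have hcut : ¬(f = f₀.1 ∨ f = G.inv f₀.1) := fun h ↦ hf (if_pos h)
  have hinv : (G.cut f₀.1).inv f = G.inv f := if_neg hcut
  rw [hinv] at hf ⊢
  by_cases h : G.bd f ∈ J ∧ G.bd (G.inv f) ∈ J
  · rw [show G.contractProj J ((G.cut f₀.1).bd f) = _ from
      G.contractProj_eq_of_mem h.1 h.2]
    exact .refl
  · let f' : (G.contract J).Ft := ⟨f, fun h' ↦ h h'.2⟩
    have hinv' : ((G.contract J).cut f₀).inv f' = (G.contract J).inv f' :=
      if_neg fun h ↦ hcut (h.imp (congrArg Subtype.val) (congrArg Subtype.val))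
    refine .single ⟨f', ?_, rfl, ?_⟩
    · rw [hinv']
      exact fun he ↦ hf (congrArg Subtype.val he)
    · rw [hinv']
      rfl

theorem two_le_card_contract {G : FGraph} {J : Finset G.Vt} (hJ : J ≠ Finset.univ) :
    2 ≤ Fintype.card (G.contract J).Vt := by
  obtain ⟨v, hv⟩ : ∃ v, v ∉ J := by
    simpa [Finset.eq_univ_iff_forall] using hJ
  exact Fintype.one_lt_card_iff.2 ⟨none, some ⟨v, hv⟩, nofun⟩

theorem Is1PI.contract {G : FGraph} {J : Finset G.Vt} (hG : G.Is1PI) (hJ : J.Nonempty)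
    (hJ' : J ≠ Finset.univ) : (G.contract J).Is1PI := by
  obtain ⟨hconn, -, htad, hcut⟩ := hG
  exact ⟨hconn.contract hJ, two_le_card_contract hJ', htad.contract J, fun f₀ hf₀ ↦
    (hcut f₀.1 fun he ↦ hf₀ (Subtype.ext he)).cut_contract f₀ hJ⟩

end FGraph

/-- **Contraction preserves connectedness and one-particle irreducibility**: if `Γ` is
connected and `J` is nonempty then `Γ/J` is connected; if `Γ` is 1PI and `J` is nonempty
with `J ≠ V(Γ)` then `Γ/J` is 1PI. -/
theorem contract_connected_and_1PI :
    (∀ (G : FGraph) (J : Finset G.Vt), G.Connected → J.Nonempty →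
      (G.contract J).Connected) ∧
    (∀ (G : FGraph) (J : Finset G.Vt), G.Is1PI → J.Nonempty → J ≠ Finset.univ →
      (G.contract J).Is1PI) :=
  ⟨fun _ _ hG hJ ↦ hG.contract hJ, fun _ _ hG hJ hJ' ↦ hG.contract hJ hJ'⟩
end
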